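/- Change of trajectory measure via state-action concentrability: For every policy π, every policy μ whose step-wise occupancy measures have full support (d_h^μ(s,a) > 0 for all 1 ≤ h ≤ H, s ∈ S_h, a ∈ A), and every family of functions f_h : S_h × A → ℝ (1 ≤ h ≤ H), setting C_sa(π;μ) := max_{1≤h≤H} max_{s∈S_h, a∈A} d_h^π(s,a)/d_h^μ(s,a), one has (E_π[Σ_{h=1}^H f_h(s_h,a_h)])² ≤ H · C_sa(π;μ) · E_μ[(Σ_{h=1}^H f_h(s_h,a_h))²]. -/

import Mathlib

open Finset

namespace TBRM

/-- `p` is a probability mass function on a finite type. -/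
def IsPMF {X : Type*} [Fintype X] (p : X → ℝ) : Prop :=
  (∀ x, 0 ≤ p x) ∧ ∑ x, p x = 1

/-- χ²-divergence between pmfs on a finite type. -/
noncomputable def chiSq {X : Type*} [Fintype X] (p q : X → ℝ) : ℝ :=
  (∑ x, p x ^ 2 / q x) - 1

variable {H : ℕ} {S : Fin (H + 1) → Type*} {A : Type*}
variable [∀ i, Fintype (S i)] [∀ i, DecidableEq (S i)] [Fintype A] [DecidableEq A]

/-- Density of a full trajectory (including the extra final state `s_{H+1}`),
under initial distribution `ρ`, transition kernels `P`, and policy `π`. -/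
noncomputable def trajDensity (ρ : S 0 → ℝ)
    (P : ∀ h : Fin H, S h.castSucc → A → S h.succ → ℝ)
    (π : ∀ h : Fin H, S h.castSucc → A → ℝ)
    (s : ∀ i : Fin (H + 1), S i) (a : Fin H → A) : ℝ :=
  ρ (s 0) * ∏ h : Fin H, (π h (s h.castSucc) (a h) * P h (s h.castSucc) (a h) (s h.succ))

/-- Expectation of a trajectory functional under policy `π`. -/
noncomputable def expTraj (ρ : S 0 → ℝ)
    (P : ∀ h : Fin H, S h.castSucc → A → S h.succ → ℝ)
    (π : ∀ h : Fin H, S h.castSucc → A → ℝ)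
    (f : (∀ i : Fin (H + 1), S i) → (Fin H → A) → ℝ) : ℝ :=
  ∑ s : ∀ i : Fin (H + 1), S i, ∑ a : Fin H → A, trajDensity ρ P π s a * f s a

/-- Step-`h` occupancy measure `d_h^π(x,b)`. -/
noncomputable def occ (ρ : S 0 → ℝ)
    (P : ∀ h : Fin H, S h.castSucc → A → S h.succ → ℝ)
    (π : ∀ h : Fin H, S h.castSucc → A → ℝ)
    (h : Fin H) (x : S h.castSucc) (b : A) : ℝ :=
  expTraj ρ P π (fun s a => if s h.castSucc = x ∧ a h = b then 1 else 0)


set_option linter.unusedSectionVars false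

theorem expTraj_add (ρ : S 0 → ℝ) (P : ∀ h : Fin H, S h.castSucc → A → S h.succ → ℝ)
    (π : ∀ h : Fin H, S h.castSucc → A → ℝ) (f g : (∀ i, S i) → (Fin H → A) → ℝ) :
    expTraj ρ P π (fun s a => f s a + g s a) = expTraj ρ P π f + expTraj ρ P π g := by
  simp only [expTraj, mul_add, Finset.sum_add_distrib]

theorem expTraj_const_mul (ρ : S 0 → ℝ) (P : ∀ h : Fin H, S h.castSucc → A → S h.succ → ℝ)
    (π : ∀ h : Fin H, S h.castSucc → A → ℝ) (c : ℝ) (f : (∀ i, S i) → (Fin H → A) → ℝ) :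
    expTraj ρ P π (fun s a => c * f s a) = c * expTraj ρ P π f := by
  simp only [expTraj, mul_left_comm _ c, Finset.mul_sum]

theorem expTraj_sum {ι : Type*} [Fintype ι] (ρ : S 0 → ℝ)
    (P : ∀ h : Fin H, S h.castSucc → A → S h.succ → ℝ)
    (π : ∀ h : Fin H, S h.castSucc → A → ℝ) (f : ι → (∀ i, S i) → (Fin H → A) → ℝ) :
    expTraj ρ P π (fun s a => ∑ i, f i s a) = ∑ i, expTraj ρ P π (f i) := by
  simp only [expTraj, Finset.mul_sum]
  rw [Finset.sum_comm]
  simp only [Finset.sum_comm (s := (Finset.univ : Finset ι))]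
  rw [Finset.sum_comm]

theorem trajDensity_nonneg (ρ : S 0 → ℝ) (hρ : IsPMF ρ)
    (P : ∀ h : Fin H, S h.castSucc → A → S h.succ → ℝ) (hP : ∀ h s a, IsPMF (P h s a))
    (π : ∀ h : Fin H, S h.castSucc → A → ℝ) (hπ : ∀ h s, IsPMF (π h s))
    (s : ∀ i, S i) (a : Fin H → A) : 0 ≤ trajDensity ρ P π s a :=
  mul_nonneg (hρ.1 _) <| Finset.prod_nonneg fun h _ =>
    mul_nonneg ((hπ h _).1 _) ((hP h _ _).1 _)

theorem expTraj_nonneg (ρ : S 0 → ℝ) (hρ : IsPMF ρ)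
    (P : ∀ h : Fin H, S h.castSucc → A → S h.succ → ℝ) (hP : ∀ h s a, IsPMF (P h s a))
    (π : ∀ h : Fin H, S h.castSucc → A → ℝ) (hπ : ∀ h s, IsPMF (π h s))
    {f : (∀ i, S i) → (Fin H → A) → ℝ} (hf : ∀ s a, 0 ≤ f s a) : 0 ≤ expTraj ρ P π f :=
  Finset.sum_nonneg fun s _ => Finset.sum_nonneg fun a _ =>
    mul_nonneg (trajDensity_nonneg ρ hρ P hP π hπ s a) (hf s a)

/-- Cauchy–Schwarz for trajectory expectations. -/
theorem sq_expTraj_mul_le (ρ : S 0 → ℝ) (hρ : IsPMF ρ)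
    (P : ∀ h : Fin H, S h.castSucc → A → S h.succ → ℝ) (hP : ∀ h s a, IsPMF (P h s a))
    (π : ∀ h : Fin H, S h.castSucc → A → ℝ) (hπ : ∀ h s, IsPMF (π h s))
    (f g : (∀ i, S i) → (Fin H → A) → ℝ) :
    expTraj ρ P π (fun s a => f s a * g s a) ^ 2 ≤
      expTraj ρ P π (fun s a => f s a ^ 2) * expTraj ρ P π (fun s a => g s a ^ 2) := by
  have h0 := trajDensity_nonneg ρ hρ P hP π hπ
  simp only [expTraj, ← Fintype.sum_prod_type']
  refine Finset.sum_sq_le_sum_mul_sum_of_sq_le_mul _ (fun i _ => ?_) (fun i _ => ?_)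
    (fun i _ => ?_)
  · exact mul_nonneg (h0 _ _) (sq_nonneg _)
  · exact mul_nonneg (h0 _ _) (sq_nonneg _)
  · exact le_of_eq (by ring)

/-- The distribution of the final state of a trajectory. -/
noncomputable def stateOcc (ρ : S 0 → ℝ)
    (P : ∀ h : Fin H, S h.castSucc → A → S h.succ → ℝ)
    (π : ∀ h : Fin H, S h.castSucc → A → ℝ) (x : S (Fin.last H)) : ℝ :=
  expTraj ρ P π (fun s _ => if s (Fin.last H) = x then 1 else 0)

theorem expTraj_last (ρ : S 0 → ℝ) (P : ∀ h : Fin H, S h.castSucc → A → S h.succ → ℝ)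
    (π : ∀ h : Fin H, S h.castSucc → A → ℝ) (φ : S (Fin.last H) → ℝ) :
    expTraj ρ P π (fun s _ => φ (s (Fin.last H))) = ∑ x, stateOcc ρ P π x * φ x := by
  simp only [stateOcc, mul_comm _ (φ _), ← expTraj_const_mul, ← expTraj_sum]
  simp

section LastStep

variable {T : Fin (H + 1 + 1) → Type*} [∀ i, Fintype (T i)]

/-- Integrating out the last action and the last transition. -/
theorem expTraj_succ (ρ : T 0 → ℝ)
    (P : ∀ h : Fin (H + 1), T h.castSucc → A → T h.succ → ℝ)
    (π : ∀ h : Fin (H + 1), T h.castSucc → A → ℝ)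
    (K : (∀ i : Fin (H + 1), T i.castSucc) → (Fin H → A) → A → T (Fin.last (H + 1)) → ℝ) :
    expTraj ρ P π (fun s a => K (Fin.init s) (Fin.init a) (a (Fin.last H)) (s (Fin.last (H + 1)))) =
      expTraj (S := fun i => T i.castSucc) ρ (fun h => P h.castSucc) (fun h => π h.castSucc)
        (fun s a => ∑ b, ∑ x, π (Fin.last H) (s (Fin.last H)) b *
          P (Fin.last H) (s (Fin.last H)) b x * K s a b x) := by
  unfold expTraj
  rw [← (Fin.snocEquiv T).sum_comp, Fintype.sum_prod_type, Finset.sum_comm]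
  refine Finset.sum_congr rfl fun s _ => ?_
  simp only [← (Fin.snocEquiv fun _ : Fin (H + 1) => A).sum_comp, Fintype.sum_prod_type]
  have key : ∀ (x : T (Fin.last (H + 1))) (b : A) (a : Fin H → A),
      trajDensity ρ P π (Fin.snoc s x) (Fin.snoc (α := fun _ => A) a b) =
        trajDensity (S := fun i => T i.castSucc) ρ (fun h => P h.castSucc)
          (fun h => π h.castSucc) s a *
          (π (Fin.last H) (s (Fin.last H)) b * P (Fin.last H) (s (Fin.last H)) b x) := by
    intro x b a
    have h0 : (Fin.snoc s x : ∀ i, T i) 0 = s 0 := Fin.snoc_castSucc (α := T) x s 0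
    have hs : ∀ h : Fin H, (Fin.snoc s x : ∀ i, T i) h.castSucc.succ = s h.succ :=
      fun h => Fin.snoc_castSucc (α := T) x s h.succ
    have hl : (Fin.snoc s x : ∀ i, T i) (Fin.last H).succ = x := Fin.snoc_last (α := T) x s
    simp only [trajDensity, Fin.prod_univ_castSucc, h0, hs, hl, Fin.snoc_castSucc, Fin.snoc_last]
    ring
  simp only [Fin.snocEquiv, Equiv.coe_fn_mk, key, Fin.snoc_last, Fin.init_snoc, Finset.mul_sum]
  rw [Finset.sum_comm]
  simp only [Finset.sum_comm (t := (Finset.univ : Finset (Fin H → A)))]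
  exact Finset.sum_congr rfl fun a _ => Finset.sum_congr rfl fun b _ =>
    Finset.sum_congr rfl fun x _ => mul_assoc _ _ _


theorem expTraj_succ_action (ρ : T 0 → ℝ)
    (P : ∀ h : Fin (H + 1), T h.castSucc → A → T h.succ → ℝ) (hP : ∀ h s a, IsPMF (P h s a))
    (π : ∀ h : Fin (H + 1), T h.castSucc → A → ℝ)
    (K : (∀ i : Fin (H + 1), T i.castSucc) → (Fin H → A) → A → ℝ) :
    expTraj ρ P π (fun s a => K (Fin.init s) (Fin.init a) (a (Fin.last H))) =
      expTraj (S := fun i => T i.castSucc) ρ (fun h => P h.castSucc) (fun h => π h.castSucc)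
        (fun s a => ∑ b, π (Fin.last H) (s (Fin.last H)) b * K s a b) := by
  rw [expTraj_succ ρ P π fun s a b _ => K s a b]
  simp only [← Finset.sum_mul, ← Finset.mul_sum, (hP _ _ _).2, mul_one]

theorem expTraj_succ_init (ρ : T 0 → ℝ)
    (P : ∀ h : Fin (H + 1), T h.castSucc → A → T h.succ → ℝ) (hP : ∀ h s a, IsPMF (P h s a))
    (π : ∀ h : Fin (H + 1), T h.castSucc → A → ℝ) (hπ : ∀ h s, IsPMF (π h s))
    (K : (∀ i : Fin (H + 1), T i.castSucc) → (Fin H → A) → ℝ) :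
    expTraj ρ P π (fun s a => K (Fin.init s) (Fin.init a)) =
      expTraj (S := fun i => T i.castSucc) ρ (fun h => P h.castSucc) (fun h => π h.castSucc)
        K := by
  rw [expTraj_succ_action ρ P hP π fun s a _ => K s a]
  simp only [← Finset.sum_mul, (hπ _ _).2, one_mul]

variable [∀ i, DecidableEq (T i)]

theorem occ_castSucc (ρ : T 0 → ℝ)
    (P : ∀ h : Fin (H + 1), T h.castSucc → A → T h.succ → ℝ) (hP : ∀ h s a, IsPMF (P h s a))
    (π : ∀ h : Fin (H + 1), T h.castSucc → A → ℝ) (hπ : ∀ h s, IsPMF (π h s))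
    (h : Fin H) (x : T h.castSucc.castSucc) (b : A) :
    occ ρ P π h.castSucc x b =
      occ (S := fun i => T i.castSucc) ρ (fun h => P h.castSucc) (fun h => π h.castSucc) h x b :=
  expTraj_succ_init ρ P hP π hπ fun s a => if s h.castSucc = x ∧ a h = b then 1 else 0

theorem occ_last (ρ : T 0 → ℝ)
    (P : ∀ h : Fin (H + 1), T h.castSucc → A → T h.succ → ℝ) (hP : ∀ h s a, IsPMF (P h s a))
    (π : ∀ h : Fin (H + 1), T h.castSucc → A → ℝ) (x : T (Fin.last H).castSucc) (b : A) :
    occ ρ P π (Fin.last H) x b =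
      stateOcc (S := fun i => T i.castSucc) ρ (fun h => P h.castSucc) (fun h => π h.castSucc) x *
        π (Fin.last H) x b := by
  rw [mul_comm]
  refine (expTraj_succ_action ρ P hP π
    fun s _ b' => if s (Fin.last H) = x ∧ b' = b then 1 else 0).trans
    (Eq.trans ?_ (expTraj_const_mul (S := fun i => T i.castSucc) ρ (fun h => P h.castSucc)
      (fun h => π h.castSucc) _ _))
  congr 1
  funext s a
  by_cases hx : s (Fin.last H) = x
  · subst hx
    simp
  · simp [hx]

end LastStep

theorem expTraj_one (ρ : S 0 → ℝ) (hρ : IsPMF ρ)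
    (P : ∀ h : Fin H, S h.castSucc → A → S h.succ → ℝ) (hP : ∀ h s a, IsPMF (P h s a))
    (π : ∀ h : Fin H, S h.castSucc → A → ℝ) (hπ : ∀ h s, IsPMF (π h s)) :
    expTraj ρ P π (fun _ _ => 1) = 1 := by
  induction H with
  | zero =>
    refine Eq.trans ?_ hρ.2
    simp only [expTraj, trajDensity, Finset.univ_unique, Finset.sum_singleton, mul_one,
      Finset.univ_eq_empty, Finset.prod_empty]
    let _ : Unique (Fin (0 + 1)) := inferInstanceAs (Unique (Fin 1))
    exact (Equiv.piUnique S).sum_comp ρ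
  | succ H ih =>
    exact (expTraj_succ_init ρ P hP π hπ fun _ _ => 1).trans
      (ih (S := fun i => S i.castSucc) ρ hρ _ (fun h => hP h.castSucc) _ fun h => hπ h.castSucc)

theorem stateOcc_isPMF (ρ : S 0 → ℝ) (hρ : IsPMF ρ)
    (P : ∀ h : Fin H, S h.castSucc → A → S h.succ → ℝ) (hP : ∀ h s a, IsPMF (P h s a))
    (π : ∀ h : Fin H, S h.castSucc → A → ℝ) (hπ : ∀ h s, IsPMF (π h s)) :
    IsPMF (stateOcc ρ P π) := by
  refine ⟨fun x => expTraj_nonneg ρ hρ P hP π hπ fun s _ => by split_ifs <;> norm_num, ?_⟩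
  have := expTraj_last ρ P π fun _ => 1
  simpa only [mul_one, expTraj_one ρ hρ P hP π hπ] using this.symm

/-- The one-step increment of the decoupling weight: the state-action density ratio minus the
state density ratio, where `d`, `e` are state distributions and `p`, `q` are action
distributions. -/
theorem exists_ratio_increment {X : Type*} [Fintype X] {d e : X → ℝ} (hd : IsPMF d) (he : IsPMF e)
    {p q : X → A → ℝ} (hp : ∀ x, IsPMF (p x)) (hq : ∀ x, IsPMF (q x)) {C : ℝ}
    (hpos : ∀ x b, 0 < e x * q x b) (hC : ∀ x b, d x * p x b ≤ C * (e x * q x b)) :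
    ∃ u : X → A → ℝ, (∀ x, ∑ b, q x b * u x b = 0) ∧
      (∀ x b, e x * (q x b * u x b) = d x * (p x b - q x b)) ∧
      ∑ x, e x * ∑ b, q x b * u x b ^ 2 ≤ C - 1 := by
  have hq0 : ∀ x b, q x b ≠ 0 := fun x b => right_ne_zero_of_mul (hpos x b).ne'
  have he0 : ∀ x b, 0 < e x := fun x b =>
    lt_of_le_of_ne (he.1 x) (left_ne_zero_of_mul (hpos x b).ne').symm
  refine ⟨fun x b => d x / e x * (p x b / q x b - 1), fun x => ?_, fun x b => ?_, ?_⟩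
  · have : ∀ b, q x b * (d x / e x * (p x b / q x b - 1)) = d x / e x * (p x b - q x b) := by
      intro b
      have := hq0 x b
      field_simp
    simp only [this, ← Finset.mul_sum, Finset.sum_sub_distrib, (hp x).2, (hq x).2, sub_self,
      mul_zero]
  · have := hq0 x b
    have := (he0 x b).ne'
    field_simp
  · have hpt : ∀ x, e x * ∑ b, q x b * (d x / e x * (p x b / q x b - 1)) ^ 2 ≤
        C * d x - (2 * d x - e x) := by
      intro x
      have hb : ∀ b, e x * (q x b * (d x / e x * (p x b / q x b - 1)) ^ 2) ≤
          (C * d x - 2 * d x * (d x / e x)) * p x b + d x * (d x / e x) * q x b := by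
        intro b
        have h1 := hq0 x b
        have h2 := (he0 x b).ne'
        have h3 : d x * p x b / (e x * q x b) ≤ C := (div_le_iff₀ (hpos x b)).2 (hC x b)
        have h4 : 0 ≤ d x * p x b := mul_nonneg (hd.1 x) ((hp x).1 b)
        have h5 := mul_le_mul_of_nonneg_right h3 h4
        have h6 : e x * (q x b * (d x / e x * (p x b / q x b - 1)) ^ 2) =
            d x * p x b / (e x * q x b) * (d x * p x b) -
              2 * d x * (d x / e x) * p x b + d x * (d x / e x) * q x b := by
          field_simp
          ring
        rw [h6]
        linarith
      have hA : Nonempty A := by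
        by_contra h
        have := (hq x).2
        rw [not_nonempty_iff] at h
        simp at this
      have hex := he0 x hA.some
      rw [Finset.mul_sum]
      refine (Finset.sum_le_sum fun b _ => hb b).trans ?_
      rw [Finset.sum_add_distrib, ← Finset.mul_sum, ← Finset.mul_sum, (hp x).2, (hq x).2]
      have : 0 ≤ e x * (d x / e x - 1) ^ 2 := mul_nonneg hex.le (sq_nonneg _)
      have h7 : e x * (d x / e x - 1) ^ 2 = d x * (d x / e x) - 2 * d x + e x := by
        field_simp
        ring
      linarith
    refine (Finset.sum_le_sum fun x _ => hpt x).trans ?_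
    rw [Finset.sum_sub_distrib, Finset.sum_sub_distrib, ← Finset.mul_sum, ← Finset.mul_sum, hd.2,
      he.2]
    linarith

theorem expTraj_weight_add_increment (ρ : S 0 → ℝ)
    (P : ∀ h : Fin H, S h.castSucc → A → S h.succ → ℝ)
    (π μ : ∀ h : Fin H, S h.castSucc → A → ℝ) (p q : S (Fin.last H) → A → ℝ)
    {G : (∀ i, S i) → (Fin H → A) → ℝ} {u : S (Fin.last H) → A → ℝ}
    (hG : ∀ φ : S (Fin.last H) → ℝ,
      expTraj ρ P μ (fun s a => φ (s (Fin.last H)) * G s a) =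
        expTraj ρ P π (fun s _ => φ (s (Fin.last H))))
    (hu : ∀ x b, stateOcc ρ P μ x * (q x b * u x b) = stateOcc ρ P π x * (p x b - q x b))
    (f : S (Fin.last H) → A → ℝ) :
    expTraj ρ P μ (fun s a => ∑ b, q (s (Fin.last H)) b *
        (f (s (Fin.last H)) b * (G s a + u (s (Fin.last H)) b))) =
      expTraj ρ P π (fun s _ => ∑ b, p (s (Fin.last H)) b * f (s (Fin.last H)) b) := by
  have h1 : ∀ (s : ∀ i, S i) (a : Fin H → A),
      ∑ b, q (s (Fin.last H)) b * (f (s (Fin.last H)) b * (G s a + u (s (Fin.last H)) b)) =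
        (∑ b, q (s (Fin.last H)) b * f (s (Fin.last H)) b) * G s a +
        ∑ b, f (s (Fin.last H)) b * (q (s (Fin.last H)) b * u (s (Fin.last H)) b) := by
    intro s a
    rw [Finset.sum_mul, ← Finset.sum_add_distrib]
    exact Finset.sum_congr rfl fun b _ => by ring
  simp only [h1]
  rw [expTraj_add, hG fun x => ∑ b, q x b * f x b,
    expTraj_last _ _ _ fun x => ∑ b, q x b * f x b,
    expTraj_last _ _ _ fun x => ∑ b, f x b * (q x b * u x b),
    expTraj_last _ _ _ fun x => ∑ b, p x b * f x b, ← Finset.sum_add_distrib]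
  refine Finset.sum_congr rfl fun x _ => ?_
  simp only [Finset.mul_sum]
  rw [← Finset.sum_add_distrib]
  exact Finset.sum_congr rfl fun b _ => by linear_combination f x b * hu x b

/-- A trajectory weight which turns `μ`-expectations of state-action functions into
`π`-expectations and whose second moment is controlled by state-action concentrability. -/
theorem exists_decoupling_weight (ρ : S 0 → ℝ) (hρ : IsPMF ρ)
    (P : ∀ h : Fin H, S h.castSucc → A → S h.succ → ℝ) (hP : ∀ h s a, IsPMF (P h s a))
    (π μ : ∀ h : Fin H, S h.castSucc → A → ℝ)
    (hπ : ∀ h s, IsPMF (π h s)) (hμ : ∀ h s, IsPMF (μ h s)) (C : ℝ)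
    (hocc : ∀ h x b, occ ρ P π h x b ≤ C * occ ρ P μ h x b)
    (hsupp : ∀ h x b, 0 < occ ρ P μ h x b) :
    ∃ G : (∀ i, S i) → (Fin H → A) → ℝ,
      (∀ (h : Fin H) (f : S h.castSucc → A → ℝ),
        expTraj ρ P μ (fun s a => f (s h.castSucc) (a h) * G s a) =
          expTraj ρ P π (fun s a => f (s h.castSucc) (a h))) ∧
      (∀ φ : S (Fin.last H) → ℝ,
        expTraj ρ P μ (fun s a => φ (s (Fin.last H)) * G s a) =
          expTraj ρ P π (fun s _ => φ (s (Fin.last H)))) ∧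
      expTraj ρ P μ (fun s a => G s a ^ 2) ≤ 1 + H * (C - 1) := by
  induction H with
  | zero =>
    refine ⟨fun _ _ => 1, fun h => h.elim0, fun φ => ?_, ?_⟩
    · simp [expTraj, trajDensity]
    · simp [expTraj_one ρ hρ P hP μ hμ]
  | succ H ih =>
    have hP' := fun h : Fin H => hP h.castSucc
    have hπ' := fun h : Fin H => hπ h.castSucc
    have hμ' := fun h : Fin H => hμ h.castSucc
    obtain ⟨G, hG, hGl, hG2⟩ := ih (S := fun i => S i.castSucc) ρ hρ (fun h => P h.castSucc) hP'
      (fun h => π h.castSucc) (fun h => μ h.castSucc) hπ' hμ'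
      (fun h x b => by
        rw [← occ_castSucc ρ P hP π hπ, ← occ_castSucc ρ P hP μ hμ]; exact hocc _ _ _)
      (fun h x b => by rw [← occ_castSucc ρ P hP μ hμ]; exact hsupp _ _ _)
    obtain ⟨u, hu0, hu1, hu2⟩ := exists_ratio_increment
      (stateOcc_isPMF (S := fun i => S i.castSucc) ρ hρ _ hP' _ hπ')
      (stateOcc_isPMF (S := fun i => S i.castSucc) ρ hρ _ hP' _ hμ')
      (hπ (Fin.last H)) (hμ (Fin.last H)) (C := C)
      (fun x b => by rw [← occ_last ρ P hP μ]; exact hsupp _ _ _)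
      (fun x b => by rw [← occ_last ρ P hP μ, ← occ_last ρ P hP π]; exact hocc _ _ _)
    have hcore := expTraj_weight_add_increment (S := fun i => S i.castSucc) ρ
      (fun h => P h.castSucc) (fun h => π h.castSucc) (fun h => μ h.castSucc)
      (π (Fin.last H)) (μ (Fin.last H)) hGl hu1
    refine ⟨fun s a => G (Fin.init s) (Fin.init a) + u (s (Fin.last H).castSucc) (a (Fin.last H)),
      fun h => ?_, fun φ => ?_, ?_⟩
    · refine Fin.lastCases (fun f => ?_) (fun h f => ?_) h
      · exact (expTraj_succ_action ρ P hP μ fun s a b =>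
          f (s (Fin.last H)) b * (G s a + u (s (Fin.last H)) b)).trans <| (hcore f).trans
          (expTraj_succ_action ρ P hP π fun s a b => f (s (Fin.last H)) b).symm
      · refine (expTraj_succ_action ρ P hP μ fun s a b =>
          f (s h.castSucc) (a h) * (G s a + u (s (Fin.last H)) b)).trans ?_
        refine Eq.trans ?_ ((hG h f).trans
          (expTraj_succ_init ρ P hP π hπ fun s a => f (s h.castSucc) (a h)).symm)
        congr 1
        funext s a
        have h1 : ∀ b, μ (Fin.last H) (s (Fin.last H)) b *
            (f (s h.castSucc) (a h) * (G s a + u (s (Fin.last H)) b)) =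
            μ (Fin.last H) (s (Fin.last H)) b * (f (s h.castSucc) (a h) * G s a) +
            f (s h.castSucc) (a h) *
              (μ (Fin.last H) (s (Fin.last H)) b * u (s (Fin.last H)) b) := fun b => by ring
        simp only [h1]
        rw [Finset.sum_add_distrib, ← Finset.sum_mul, ← Finset.mul_sum, hu0, (hμ _ _).2]
        ring
    · refine (expTraj_succ ρ P μ fun s a b x =>
        φ x * (G s a + u (s (Fin.last H)) b)).trans <| Eq.trans ?_ <|
        (hcore fun y b => ∑ x, P (Fin.last H) y b x * φ x).trans <| Eq.trans ?_
        (expTraj_succ ρ P π fun s a b x => φ x).symm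
      · simp only [Finset.mul_sum, Finset.sum_mul, mul_assoc]
      · simp only [Finset.mul_sum, mul_assoc]
    · have h1 : ∀ (s : ∀ i : Fin (H + 1), S i.castSucc) (a : Fin H → A),
          ∑ b, μ (Fin.last H) (s (Fin.last H)) b * (G s a + u (s (Fin.last H)) b) ^ 2 =
          G s a ^ 2 +
            ∑ b, μ (Fin.last H) (s (Fin.last H)) b * u (s (Fin.last H)) b ^ 2 := by
        intro s a
        have h2 : ∀ b, μ (Fin.last H) (s (Fin.last H)) b * (G s a + u (s (Fin.last H)) b) ^ 2 =
            μ (Fin.last H) (s (Fin.last H)) b * G s a ^ 2 +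
            2 * G s a * (μ (Fin.last H) (s (Fin.last H)) b * u (s (Fin.last H)) b) +
            μ (Fin.last H) (s (Fin.last H)) b * u (s (Fin.last H)) b ^ 2 := fun b => by ring
        simp only [h2]
        rw [Finset.sum_add_distrib, Finset.sum_add_distrib, ← Finset.sum_mul, ← Finset.mul_sum,
          hu0, (hμ _ _).2]
        ring
      refine (expTraj_succ_action ρ P hP μ fun s a b =>
        (G s a + u (s (Fin.last H)) b) ^ 2).trans_le ?_
      simp only [h1]
      refine (expTraj_add (S := fun i => S i.castSucc) _ _ _ _ _).trans_le ?_
      refine (congrArg (_ + ·) (expTraj_last (S := fun i => S i.castSucc) _ _ _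
          fun x => ∑ b, μ (Fin.last H) x b * u x b ^ 2)).trans_le ?_
      push_cast
      linarith

/-- **Change of trajectory measure via state-action concentrability.** With
`C_sa(π;μ) := max_{h,s,a} d_h^π(s,a) / d_h^μ(s,a)` (written as an `iSup` over the finitely
many step/state/action triples), the square of the expected trajectory sum under `π` is at
most `H · C_sa(π;μ)` times the second moment of the trajectory sum under `μ`. -/
theorem change_of_trajectory_measure_concentrability
    (hH : 0 < H) [∀ i, Nonempty (S i)] [Nonempty A]
    (ρ : S 0 → ℝ) (hρ : IsPMF ρ)
    (P : ∀ h : Fin H, S h.castSucc → A → S h.succ → ℝ)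
    (hP : ∀ h s a, IsPMF (P h s a))
    (π μ : ∀ h : Fin H, S h.castSucc → A → ℝ)
    (hπ : ∀ h s, IsPMF (π h s)) (hμ : ∀ h s, IsPMF (μ h s))
    (hsupp : ∀ (h : Fin H) (s : S h.castSucc) (a : A), 0 < occ ρ P μ h s a)
    (f : ∀ h : Fin H, S h.castSucc → A → ℝ) :
    (expTraj ρ P π (fun s a => ∑ h : Fin H, f h (s h.castSucc) (a h))) ^ 2 ≤
      (H : ℝ) *
        (⨆ h : Fin H, ⨆ s : S h.castSucc, ⨆ a : A,
          occ ρ P π h s a / occ ρ P μ h s a) *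
        expTraj ρ P μ (fun s a => (∑ h : Fin H, f h (s h.castSucc) (a h)) ^ 2) := by
  set C := ⨆ h : Fin H, ⨆ s : S h.castSucc, ⨆ a : A, occ ρ P π h s a / occ ρ P μ h s a
  have hocc : ∀ h x b, occ ρ P π h x b ≤ C * occ ρ P μ h x b := by
    intro h x b
    rw [← div_le_iff₀ (hsupp h x b)]
    refine le_trans ?_ (le_ciSup (Set.finite_range _).bddAbove h)
    refine le_trans ?_ (le_ciSup (Set.finite_range _).bddAbove x)
    exact le_ciSup (f := fun a => occ ρ P π h x a / occ ρ P μ h x a)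
      (Set.finite_range _).bddAbove b
  obtain ⟨G, hG, -, hG2⟩ := exists_decoupling_weight ρ hρ P hP π μ hπ hμ C hocc hsupp
  have hmean : expTraj ρ P π (fun s a => ∑ h : Fin H, f h (s h.castSucc) (a h)) =
      expTraj ρ P μ (fun s a => (∑ h : Fin H, f h (s h.castSucc) (a h)) * G s a) := by
    simp only [Finset.sum_mul, expTraj_sum]
    exact Finset.sum_congr rfl fun h _ => (hG h (f h)).symm
  have hF : 0 ≤ expTraj ρ P μ (fun s a => (∑ h : Fin H, f h (s h.castSucc) (a h)) ^ 2) :=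
    expTraj_nonneg ρ hρ P hP μ hμ fun s a => sq_nonneg _
  have hH' : (1 : ℝ) ≤ H := by exact_mod_cast hH
  rw [hmean]
  calc _ ≤ _ := sq_expTraj_mul_le ρ hρ P hP μ hμ _ _
    _ ≤ _ := by
      rw [mul_comm]
      exact mul_le_mul_of_nonneg_right (by linarith) hF

end TBRM
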